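/- Let (A^{p,q}, ∂, ∂̄) be a bounded double complex of complex vector spaces satisfying the ∂∂̄-lemma, and let p ≤ k be integers. Then the natural map ⊕_{r≥p} H^{r,k−r}_{BC}(A) → H^k_d(A) is injective, and its image F^p H^k(A) is exactly the set of de Rham classes [σ] ∈ H^k_d(A) admitting a representative σ ∈ F^p A^k with dσ = 0; consequently, if the Bott–Chern cohomology groups are finite dimensional, dim F^p H^k(A) = Σ_{r≥p} dim H^{r,k−r}_{BC}(A). -/

import Mathlib

/-!
STATEMENT 5: For a bounded double complex `(A^{p,q}, ∂, ∂̄)` of complex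
vector spaces satisfying the ∂∂̄-lemma and integers `p ≤ k`:
the natural map `⊕_{r≥p} H^{r,k-r}_{BC}(A) → H^k_d(A)` is injective, its
image `F^p H^k(A)` is exactly the set of de Rham classes admitting a
`d`-closed representative in `F^p A^k`, and, if the Bott–Chern groups are
finite dimensional, `dim F^p H^k(A) = Σ_{r≥p} dim H^{r,k-r}_{BC}(A)`.

Formalization: injectivity is expressed at the level of representatives;
the image of `⊕_{r≥p} H^{r,k-r}_{BC}(A)` in `H^k_d(A)` is the subspace
`FpH` of classes of elements of `⨆_{r≥p} (ker ∂ ∩ ker ∂̄ ∩ A^{r,k-r})`, and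
the set of classes with a `d`-closed representative in `F^p A^k` is the
subspace of classes of elements of `ker d` lying in `F^p A^k`.
-/

open LinearMap Submodule

/-- A bounded double complex of complex vector spaces, realized as a bigraded
family of subspaces `A (p, q)` of an ambient space `V` (whose internal direct
sum is `V`), with anticommuting square-zero operators `D = ∂` of bidegree
`(1,0)` and `Db = ∂̄` of bidegree `(0,1)`, and only finitely many nonzero
pieces. -/
structure IsBoundedDoubleComplex {V : Type*} [AddCommGroup V] [Module ℂ V]
    (A : ℤ × ℤ → Submodule ℂ V) (D Db : V →ₗ[ℂ] V) : Prop where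
  internal : DirectSum.IsInternal A
  bounded : {pq : ℤ × ℤ | A pq ≠ ⊥}.Finite
  mapD : ∀ p q : ℤ, Submodule.map D (A (p, q)) ≤ A (p + 1, q)
  mapDb : ∀ p q : ℤ, Submodule.map Db (A (p, q)) ≤ A (p, q + 1)
  ddzero : D ∘ₗ D = 0
  dbdbzero : Db ∘ₗ Db = 0
  anticomm : D ∘ₗ Db + Db ∘ₗ D = 0

variable {V : Type*} [AddCommGroup V] [Module ℂ V]

/-- The total-degree-`k` part `A^k = ⊕_{p+q=k} A^{p,q}`. -/
def Ak (A : ℤ × ℤ → Submodule ℂ V) (k : ℤ) : Submodule ℂ V :=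
  ⨆ r : ℤ, A (r, k - r)

/-- The Hodge filtration at the level of forms:
`F^p A^k = ⊕_{r ≥ p} A^{r,k-r}`. -/
def FpA (A : ℤ × ℤ → Submodule ℂ V) (p k : ℤ) : Submodule ℂ V :=
  ⨆ r : ℤ, ⨆ _ : p ≤ r, A (r, k - r)

/-- The `d`-closed elements of total degree `k`: `ker d ∩ A^k`. -/
def Zd (A : ℤ × ℤ → Submodule ℂ V) (D Db : V →ₗ[ℂ] V) (k : ℤ) : Submodule ℂ V :=
  ker (D + Db) ⊓ Ak A k

/-- The `d`-exact elements of total degree `k`, viewed inside `Zd`. -/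
abbrev BdZ (A : ℤ × ℤ → Submodule ℂ V) (D Db : V →ₗ[ℂ] V) (k : ℤ) :
    Submodule ℂ ↥(Zd A D Db k) :=
  (range (D + Db) ⊓ Ak A k).comap (Zd A D Db k).subtype

/-- The degree-`k` de Rham cohomology `H^k_d(A) = (ker d ∩ A^k)/(im d ∩ A^k)`. -/
abbrev Hd (A : ℤ × ℤ → Submodule ℂ V) (D Db : V →ₗ[ℂ] V) (k : ℤ) :=
  ↥(Zd A D Db k) ⧸ BdZ A D Db k

/-- The Bott–Chern `(p,q)`-cocycles `ker ∂ ∩ ker ∂̄ ∩ A^{p,q}`. -/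
def ZBC (A : ℤ × ℤ → Submodule ℂ V) (D Db : V →ₗ[ℂ] V) (p q : ℤ) :
    Submodule ℂ V :=
  ker D ⊓ ker Db ⊓ A (p, q)

/-- The Bott–Chern cohomology
`H^{p,q}_{BC}(A) = (ker ∂ ∩ ker ∂̄ ∩ A^{p,q})/(im ∂∂̄ ∩ A^{p,q})`. -/
abbrev HBC (A : ℤ × ℤ → Submodule ℂ V) (D Db : V →ₗ[ℂ] V) (p q : ℤ) :=
  ↥(ZBC A D Db p q) ⧸
    ((range (D ∘ₗ Db) ⊓ A (p, q)).comap (ZBC A D Db p q).subtype)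

/-- `F^p H^k(A)`: the image of `⊕_{r≥p} H^{r,k-r}_{BC}(A)` in `H^k_d(A)`,
i.e. the subspace of classes of sums of `d`-closed pure-type elements
`β^{r,k-r}` with `r ≥ p`. -/
def FpH (A : ℤ × ℤ → Submodule ℂ V) (D Db : V →ₗ[ℂ] V) (p k : ℤ) :
    Submodule ℂ (Hd A D Db k) :=
  Submodule.map (BdZ A D Db k).mkQ
    ((⨆ r : ℤ, ⨆ _ : p ≤ r, ZBC A D Db r (k - r)).comap (Zd A D Db k).subtype)

/-- Existence of the bigraded projections. -/
lemma exists_proj (A : ℤ × ℤ → Submodule ℂ V) (h : DirectSum.IsInternal A) :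
    ∃ π : ℤ × ℤ → V →ₗ[ℂ] V, (∀ i x, π i x ∈ A i) ∧ (∀ i, ∀ x ∈ A i, π i x = x) ∧
      (∀ i j, j ≠ i → ∀ x ∈ A j, π i x = 0) := by
  classical
  letI := h.chooseDecomposition
  refine ⟨fun i => (A i).subtype ∘ₗ DirectSum.component ℂ _ _ i ∘ₗ
    (DirectSum.decomposeLinearEquiv A).toLinearMap, ?_, ?_, ?_⟩
  · intro i x
    simp
  · intro i x hx
    exact DirectSum.decompose_of_mem_same A hx
  · intro i j hij x hx
    exact DirectSum.decompose_of_mem_ne A hx hij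

/-- Packaged projections commuting with the differentials. -/
lemma exists_proj_comm (A : ℤ × ℤ → Submodule ℂ V) (D Db : V →ₗ[ℂ] V)
    (hc : IsBoundedDoubleComplex A D Db) :
    ∃ π : ℤ × ℤ → V →ₗ[ℂ] V, (∀ i x, π i x ∈ A i) ∧ (∀ i, ∀ x ∈ A i, π i x = x) ∧
      (∀ i j, j ≠ i → ∀ x ∈ A j, π i x = 0) ∧
      (∀ r s x, π (r, s) (D x) = D (π (r - 1, s) x)) ∧
      (∀ r s x, π (r, s) (Db x) = Db (π (r, s - 1) x)) := by
  obtain ⟨π, h1, h2, h3⟩ := exists_proj A hc.internal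
  have htop := hc.internal.submodule_iSup_eq_top
  refine ⟨π, h1, h2, h3, ?_, ?_⟩
  · intro r s x
    have hx : x ∈ ⨆ i, A i := htop ▸ Submodule.mem_top
    induction hx using Submodule.iSup_induction' with
    | mem i x hx =>
      obtain ⟨a, b⟩ := i
      have hD : D x ∈ A (a + 1, b) := hc.mapD a b (Submodule.mem_map_of_mem hx)
      by_cases hab : (a, b) = (r - 1, s)
      · rw [← hab, h2 _ _ hx, h2 _ _]
        simp only [Prod.mk.injEq] at hab
        obtain ⟨rfl, rfl⟩ := hab
        simpa using hD
      · rw [h3 _ _ hab _ hx, h3 _ _ _ _ hD, map_zero]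
        intro hh
        simp only [Prod.mk.injEq] at hh hab
        exact hab ⟨by omega, hh.2⟩
    | zero => simp
    | add x y _ _ hx hy => simp [hx, hy]
  · intro r s x
    have hx : x ∈ ⨆ i, A i := htop ▸ Submodule.mem_top
    induction hx using Submodule.iSup_induction' with
    | mem i x hx =>
      obtain ⟨a, b⟩ := i
      have hD : Db x ∈ A (a, b + 1) := hc.mapDb a b (Submodule.mem_map_of_mem hx)
      by_cases hab : (a, b) = (r, s - 1)
      · rw [← hab, h2 _ _ hx, h2 _ _]
        simp only [Prod.mk.injEq] at hab
        obtain ⟨rfl, rfl⟩ := hab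
        simpa using hD
      · rw [h3 _ _ hab _ hx, h3 _ _ _ _ hD, map_zero]
        intro hh
        simp only [Prod.mk.injEq] at hh hab
        exact hab ⟨hh.1, by omega⟩
    | zero => simp
    | add x y _ _ hx hy => simp [hx, hy]

/-- Injectivity on representatives, with a finite sum. -/
lemma inj_finset (A : ℤ × ℤ → Submodule ℂ V) (D Db : V →ₗ[ℂ] V)
    (hc : IsBoundedDoubleComplex A D Db)
    (hlem : ker D ⊓ ker Db ⊓ (range D ⊔ range Db) = range (D ∘ₗ Db)) (k : ℤ)
    (S : Finset ℤ) (β : ℤ → V) (hβ : ∀ r, β r ∈ ZBC A D Db r (k - r))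
    (hs : ∑ r ∈ S, β r ∈ range (D + Db)) (r : ℤ) (hr : r ∈ S) :
    β r ∈ range (D ∘ₗ Db) := by
  obtain ⟨π, h1, h2, h3, hD, hDb⟩ := exists_proj_comm A D Db hc
  obtain ⟨α, hα⟩ := hs
  have e : π (r, k - r) (∑ r ∈ S, β r) = β r := by
    rw [map_sum, Finset.sum_eq_single r]
    · exact h2 _ _ (hβ r).2
    · intro b _ hb
      refine h3 _ (b, k - b) ?_ _ (hβ b).2
      simp [hb]
    · exact fun h => absurd hr h
  rw [← hlem]
  refine ⟨(hβ r).1, ?_⟩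
  rw [← e, ← hα, LinearMap.add_apply, map_add, hD, hDb]
  exact Submodule.add_mem_sup ⟨_, rfl⟩ ⟨_, rfl⟩

lemma support_finite (A : ℤ × ℤ → Submodule ℂ V) (D Db : V →ₗ[ℂ] V)
    (hc : IsBoundedDoubleComplex A D Db) (k : ℤ) :
    {r : ℤ | A (r, k - r) ≠ ⊥}.Finite := by
  have := hc.bounded.preimage (f := fun r : ℤ => (r, k - r)) (by
    intro a _ b _ h
    simpa using (Prod.mk.inj h).1)
  exact this

lemma FpA_le_Ak (A : ℤ × ℤ → Submodule ℂ V) (p k : ℤ) : FpA A p k ≤ Ak A k :=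
  iSup_le fun r => iSup_le fun _ => le_iSup (fun r : ℤ => A (r, k - r)) r

lemma FpA_le_succ (A : ℤ × ℤ → Submodule ℂ V) (p k : ℤ) :
    FpA A p k ≤ A (p, k - p) ⊔ FpA A (p + 1) k := by
  refine iSup_le fun r => iSup_le fun hr => ?_
  rcases hr.eq_or_lt with rfl | hr
  · exact le_sup_left
  · exact le_trans (le_iSup₂_of_le (f := fun r (_ : p + 1 ≤ r) => A (r, k - r)) r hr le_rfl)
      le_sup_right

/-- Every closed element of `F^p A^k` is cohomologous to a sum of Bott–Chern cocycles. -/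
lemma exists_rep (A : ℤ × ℤ → Submodule ℂ V) (D Db : V →ₗ[ℂ] V)
    (hc : IsBoundedDoubleComplex A D Db)
    (hlem : ker D ⊓ ker Db ⊓ (range D ⊔ range Db) = range (D ∘ₗ Db)) (k : ℤ)
    (n : ℕ) : ∀ p : ℤ, (∀ r, p + n ≤ r → A (r, k - r) = ⊥) →
    ∀ σ ∈ FpA A p k, (D + Db) σ = 0 →
    ∃ τ ∈ ⨆ r : ℤ, ⨆ _ : p ≤ r, ZBC A D Db r (k - r), σ - τ ∈ range (D + Db) := by
  obtain ⟨π, h1, h2, h3, hD, hDb⟩ := exists_proj_comm A D Db hc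
  have dd : ∀ x, D (D x) = 0 := fun x => LinearMap.congr_fun hc.ddzero x
  have bb : ∀ x, Db (Db x) = 0 := fun x => LinearMap.congr_fun hc.dbdbzero x
  have ac : ∀ x, D (Db x) + Db (D x) = 0 := fun x => LinearMap.congr_fun hc.anticomm x
  have hlow : ∀ p r s : ℤ, r < p → ∀ b ∈ FpA A p k, π (r, s) b = 0 := by
    intro p r s hr b hb
    have : FpA A p k ≤ ker (π (r, s)) := by
      refine iSup_le fun t => iSup_le fun ht x hx => ?_
      refine h3 _ _ ?_ _ hx
      intro hh
      have := (Prod.mk.inj hh).1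
      omega
    exact this hb
  induction n with
  | zero =>
    intro p hp σ hσ _
    have : FpA A p k = ⊥ := by
      rw [eq_bot_iff]
      refine iSup_le fun t => iSup_le fun ht => ?_
      rw [hp t (by simpa using ht)]
    rw [this, Submodule.mem_bot] at hσ
    subst hσ
    exact ⟨0, Submodule.zero_mem _, by simp⟩
  | succ n ih =>
    intro p hp σ hσ hdσ
    obtain ⟨a, ha, b, hb, rfl⟩ := Submodule.mem_sup.1 (FpA_le_succ A p k hσ)
    have e1 : Db a = 0 := by
      have := congrArg (π (p, k - p + 1)) hdσ
      simp only [LinearMap.add_apply, map_add, hD, hDb, map_zero, add_sub_cancel_right] at this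
      rw [h2 _ _ ha, hlow (p + 1) _ _ (by omega) b hb, hlow (p + 1) _ _ (by omega) b hb,
        h3 _ _ _ _ ha] at this
      · simpa using this
      · simp
    have e2 : D a = Db (- π (p + 1, k - p - 1) b) := by
      have := congrArg (π (p + 1, k - p)) hdσ
      simp only [LinearMap.add_apply, map_add, hD, hDb, map_zero, add_sub_cancel_right] at this
      rw [h2 _ _ ha, hlow (p + 1) _ _ (by omega) b hb, h3 _ _ _ _ ha] at this
      · rw [map_neg, eq_neg_iff_add_eq_zero]
        simpa using this
      · simp
    have e3 : D a ∈ range (D ∘ₗ Db) := by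
      rw [← hlem]
      refine ⟨⟨dd a, ?_⟩, Submodule.mem_sup_left ⟨a, rfl⟩⟩
      change Db (D a) = 0
      rw [e2, bb]
    obtain ⟨γ, hγ⟩ := e3
    have hDa : D a ∈ A (p + 1, k - p) := hc.mapD _ _ (Submodule.mem_map_of_mem ha)
    have e4 : D (Db (π (p, k - p - 1) γ)) = D a := by
      have := congrArg (π (p + 1, k - p)) hγ
      rw [h2 _ _ hDa, LinearMap.comp_apply, hD, hDb] at this
      simpa using this
    set g := π (p, k - p - 1) γ with hg
    have hgA : g ∈ A (p, k - p - 1) := h1 _ _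
    have hDbg : Db g ∈ A (p, k - p) := by
      simpa using hc.mapDb _ _ (Submodule.mem_map_of_mem hgA)
    have hDg : D g ∈ A (p + 1, k - (p + 1)) := by
      have := hc.mapD _ _ (Submodule.mem_map_of_mem hgA)
      rwa [show k - (p + 1) = k - p - 1 by ring]
    have hz : a - Db g ∈ ZBC A D Db p (k - p) := by
      refine ⟨⟨?_, ?_⟩, Submodule.sub_mem _ ha hDbg⟩
      · simp [e4]
      · simp [e1, bb]
    have hb' : b - D g ∈ FpA A (p + 1) k :=
      Submodule.sub_mem _ hb (le_iSup₂_of_le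
        (f := fun r (_ : p + 1 ≤ r) => A (r, k - r)) (p + 1) le_rfl le_rfl hDg)
    have hcl : (D + Db) (b - D g) = 0 := by
      have q1 : D a + D b + (Db a + Db b) = 0 := by simpa using hdσ
      have q2 := ac g
      rw [e4] at q2
      simp only [LinearMap.add_apply, map_sub, dd]
      rw [e1, zero_add] at q1
      have q3 := sub_eq_zero.2 (q1.trans q2.symm)
      refine Eq.trans ?_ q3
      abel
    obtain ⟨τ, hτ, x, hx⟩ := ih (p + 1) (fun r hr => hp r (by push_cast; omega)) _ hb' hcl
    refine ⟨(a - Db g) + τ, Submodule.add_mem _ ?_ ?_, x + g, ?_⟩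
    · exact le_iSup₂_of_le (f := fun r (_ : p ≤ r) => ZBC A D Db r (k - r)) p le_rfl le_rfl hz
    · refine (iSup_le fun r => iSup_le fun hr => ?_ :
        (⨆ r : ℤ, ⨆ _ : p + 1 ≤ r, ZBC A D Db r (k - r)) ≤ _) hτ
      exact le_iSup₂_of_le (f := fun r (_ : p ≤ r) => ZBC A D Db r (k - r)) r (by omega) le_rfl
    · rw [map_add, hx]
      simp only [LinearMap.add_apply]
      abel

lemma ZBC_le_Zd (A : ℤ × ℤ → Submodule ℂ V) (D Db : V →ₗ[ℂ] V) (r k : ℤ) :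
    ZBC A D Db r (k - r) ≤ Zd A D Db k := by
  intro x hx
  refine ⟨?_, le_iSup (fun r : ℤ => A (r, k - r)) r hx.2⟩
  have h1 : D x = 0 := hx.1.1
  have h2 : Db x = 0 := hx.1.2
  simp [h1, h2]

/-- The natural map from Bott–Chern to de Rham cohomology. -/
noncomputable def natMap (A : ℤ × ℤ → Submodule ℂ V) (D Db : V →ₗ[ℂ] V)
    (hc : IsBoundedDoubleComplex A D Db) (k r : ℤ) :
    HBC A D Db r (k - r) →ₗ[ℂ] Hd A D Db k :=
  Submodule.mapQ _ _ (Submodule.inclusion (ZBC_le_Zd A D Db r k)) (by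
    rintro ⟨x, hx⟩ ⟨⟨y, hy⟩, h2⟩
    refine ⟨⟨Db y, ?_⟩, (ZBC_le_Zd A D Db r k hx).2⟩
    have : Db (Db y) = 0 := LinearMap.congr_fun hc.dbdbzero y
    rw [LinearMap.add_apply, this, add_zero]
    exact hy)

lemma sum_natMap_mk (A : ℤ × ℤ → Submodule ℂ V) (D Db : V →ₗ[ℂ] V)
    (hc : IsBoundedDoubleComplex A D Db) (k : ℤ) (S : Finset ℤ)
    (z : ∀ r : ℤ, ZBC A D Db r (k - r)) :
    ∑ r ∈ S, natMap A D Db hc k r (Submodule.Quotient.mk (z r)) =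
      (BdZ A D Db k).mkQ (∑ r ∈ S, Submodule.inclusion (ZBC_le_Zd A D Db r k) (z r)) := by
  rw [map_sum]
  rfl

lemma finrank_FpH (A : ℤ × ℤ → Submodule ℂ V) (D Db : V →ₗ[ℂ] V)
    (hc : IsBoundedDoubleComplex A D Db)
    (hlem : ker D ⊓ ker Db ⊓ (range D ⊔ range Db) = range (D ∘ₗ Db)) (p k : ℤ)
    (hfin : ∀ r : ℤ, FiniteDimensional ℂ (HBC A D Db r (k - r))) :
    Module.finrank ℂ (FpH A D Db p k)
        = ∑ᶠ (r : ℤ) (_ : p ≤ r), Module.finrank ℂ (HBC A D Db r (k - r)) := by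
  classical
  set S : Finset ℤ := (support_finite A D Db hc k).toFinset.filter (fun r => p ≤ r) with hS
  have hmem : ∀ r, r ∈ S ↔ A (r, k - r) ≠ ⊥ ∧ p ≤ r := by simp [hS]
  let Φ : (∀ r : S, HBC A D Db r (k - r)) →ₗ[ℂ] Hd A D Db k :=
    ∑ r : S, natMap A D Db hc k r ∘ₗ LinearMap.proj r
  have hΦ : ∀ z : ∀ r : ℤ, ZBC A D Db r (k - r),
      Φ (fun r => Submodule.Quotient.mk (z r)) =
      (BdZ A D Db k).mkQ (∑ r ∈ S, Submodule.inclusion (ZBC_le_Zd A D Db r k) (z r)) := by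
    intro z
    rw [← sum_natMap_mk A D Db hc, ← Finset.sum_coe_sort]
    simp only [Φ, LinearMap.sum_apply, LinearMap.comp_apply, LinearMap.proj_apply]
  have hrep : ∀ f : (∀ r : S, HBC A D Db r (k - r)), ∃ z : ∀ r : ℤ, ZBC A D Db r (k - r),
      f = fun r : S => Submodule.Quotient.mk (z r) := by
    intro f
    have : ∀ r : ℤ, ∃ z : ZBC A D Db r (k - r), ∀ h : r ∈ S,
        f ⟨r, h⟩ = Submodule.Quotient.mk z := by
      intro r
      by_cases h : r ∈ S
      · obtain ⟨z, hz⟩ := Submodule.Quotient.mk_surjective _ (f ⟨r, h⟩)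
        exact ⟨z, fun _ => hz.symm⟩
      · exact ⟨0, fun h' => absurd h' h⟩
    choose z hz using this
    exact ⟨z, funext fun r => hz r r.2⟩
  have hinj : Function.Injective Φ := by
    rw [← LinearMap.ker_eq_bot, LinearMap.ker_eq_bot']
    intro f hf
    obtain ⟨z, rfl⟩ := hrep f
    rw [hΦ, Submodule.mkQ_apply, Submodule.Quotient.mk_eq_zero] at hf
    have hs : ∑ r ∈ S, ((z r : V)) ∈ range (D + Db) := by
      have := hf.1
      simpa using this
    funext r
    have := inj_finset A D Db hc hlem k S (fun r => z r) (fun r => (z r).2) hs r r.2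
    exact (Submodule.Quotient.mk_eq_zero _).2 ⟨this, (z r).2.2⟩
  have hrange : LinearMap.range Φ = FpH A D Db p k := by
    apply le_antisymm
    · rintro _ ⟨f, rfl⟩
      obtain ⟨z, rfl⟩ := hrep f
      rw [hΦ]
      refine Submodule.mem_map_of_mem ?_
      refine Submodule.sum_mem _ fun r hr => ?_
      exact le_iSup₂_of_le (f := fun r (_ : p ≤ r) => ZBC A D Db r (k - r)) r
        ((hmem r).1 hr).2 le_rfl (z r).2
    · rintro _ ⟨⟨x, hx⟩, hx', rfl⟩
      have key : (⨆ r : ℤ, ⨆ _ : p ≤ r, ZBC A D Db r (k - r)) ≤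
          Submodule.map (Zd A D Db k).subtype
            (Submodule.comap (BdZ A D Db k).mkQ (LinearMap.range Φ)) := by
        refine iSup_le fun r => iSup_le fun hr y hy => ?_
        refine ⟨⟨y, ZBC_le_Zd A D Db r k hy⟩, ?_, rfl⟩
        by_cases hb : A (r, k - r) = ⊥
        · have : y = 0 := by simpa [hb] using hy.2
          subst this
          exact Submodule.zero_mem _
        · have hrS : r ∈ S := (hmem r).2 ⟨hb, hr⟩
          refine ⟨Pi.single (⟨r, hrS⟩ : S) (Submodule.Quotient.mk ⟨y, hy⟩), ?_⟩
          simp only [Φ, LinearMap.sum_apply, LinearMap.comp_apply, LinearMap.proj_apply]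
          rw [Finset.sum_eq_single (⟨r, hrS⟩ : S)]
          · rw [Pi.single_eq_same]
            rfl
          · intro b _ hb
            rw [Pi.single_eq_of_ne hb, map_zero]
          · simp
      obtain ⟨w, hw, hwx⟩ := key hx'
      have : w = ⟨x, hx⟩ := Subtype.ext hwx
      subst this
      exact hw
  rw [← hrange, LinearMap.finrank_range_of_inj hinj, Module.finrank_pi_fintype,
    Finset.sum_coe_sort S (fun r => Module.finrank ℂ (HBC A D Db r (k - r)))]
  symm
  rw [finsum_eq_sum_of_support_subset (s := S)]
  · refine Finset.sum_congr rfl fun r hr => ?_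
    rw [finsum_eq_if, if_pos ((hmem r).1 hr).2]
  · intro r hr
    rw [Function.mem_support, finsum_eq_if] at hr
    by_cases hp : p ≤ r
    · rw [if_pos hp] at hr
      refine (hmem r).2 ⟨fun hb => hr ?_, hp⟩
      have : Subsingleton (ZBC A D Db r (k - r)) := by
        refine ⟨fun x y => Subtype.ext ?_⟩
        have h1 : (x : V) = 0 := by simpa [hb] using x.2.2
        have h2 : (y : V) = 0 := by simpa [hb] using y.2.2
        rw [h1, h2]
      have : Subsingleton (HBC A D Db r (k - r)) :=
        (Submodule.Quotient.mk_surjective _).subsingleton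
      exact Module.finrank_zero_of_subsingleton
    · simp [hp] at hr

theorem hodge_filtration_injective_image_dim
    (A : ℤ × ℤ → Submodule ℂ V) (D Db : V →ₗ[ℂ] V)
    (hc : IsBoundedDoubleComplex A D Db)
    (hlem : ker D ⊓ ker Db ⊓ (range D ⊔ range Db) = range (D ∘ₗ Db))
    (p k : ℤ) (hpk : p ≤ k) :
    -- injectivity of `⊕_{r≥p} H^{r,k-r}_{BC}(A) → H^k_d(A)`
    (∀ β : ℤ → V, (∀ r, β r ∈ ZBC A D Db r (k - r)) → (∀ r, r < p → β r = 0) →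
        (∑ᶠ r : ℤ, β r) ∈ range (D + Db) → ∀ r, β r ∈ range (D ∘ₗ Db)) ∧
    -- the image is the set of classes with a `d`-closed representative in `F^p A^k`
    FpH A D Db p k
      = Submodule.map (BdZ A D Db k).mkQ
          ((FpA A p k).comap (Zd A D Db k).subtype) ∧
    -- dimension count
    ((∀ r : ℤ, FiniteDimensional ℂ (HBC A D Db r (k - r))) →
      Module.finrank ℂ (FpH A D Db p k)
        = ∑ᶠ (r : ℤ) (_ : p ≤ r), Module.finrank ℂ (HBC A D Db r (k - r))) := by
  refine ⟨?_, ?_, finrank_FpH A D Db hc hlem p k⟩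
  · intro β hβ _ hs r
    have hsub : Function.support β ⊆ {r : ℤ | A (r, k - r) ≠ ⊥} := by
      intro r hr hb
      exact hr (by simpa [hb] using (hβ r).2)
    have hf := (support_finite A D Db hc k).subset hsub
    by_cases h0 : β r = 0
    · rw [h0]
      exact Submodule.zero_mem _
    · rw [finsum_eq_sum β hf] at hs
      exact inj_finset A D Db hc hlem k _ β hβ hs r (by simpa using h0)
  · apply le_antisymm
    · refine Submodule.map_mono (Submodule.comap_mono ?_)
      exact iSup_mono fun r => iSup_mono fun _ => inf_le_right
    · rintro _ ⟨⟨σ, hσ⟩, hσF, rfl⟩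
      obtain ⟨N, hN⟩ := (support_finite A D Db hc k).bddAbove
      obtain ⟨τ, hτ, hd⟩ := exists_rep A D Db hc hlem k (N + 1 - p).toNat p (by
        intro r hr
        by_contra hb
        have := hN hb
        omega) σ hσF hσ.1
      have hτZ : τ ∈ Zd A D Db k :=
        (iSup_le fun r => iSup_le fun _ => ZBC_le_Zd A D Db r k :
          (⨆ r : ℤ, ⨆ _ : p ≤ r, ZBC A D Db r (k - r)) ≤ _) hτ
      refine ⟨⟨τ, hτZ⟩, hτ, ?_⟩
      symm
      refine (Submodule.Quotient.eq _).2 ?_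
      exact ⟨hd, Submodule.sub_mem _ hσ.2 hτZ.2⟩
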